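/- arXiv:1702.05937 — 4 statements merged into one kernel-verified Lean document; each statement's English description precedes it below -/
import Mathlib

section
/- Let k be a field of characteristic 0 and V a finite-dimensional k-vector space carrying two triple-compatible Lie brackets ⁅·,·⁆ and ⁅·,·⁆′. If the Lie algebra g = (V,⁅·,·⁆) is semisimple, then g′ = (V,⁅·,·⁆′) is also semisimple, and there exist linear subspaces V₊, V₋ ⊆ V with V = V₊ ⊕ V₋ such that V₊ and V₋ are ideals for both brackets, ⁅a,b⁆′ = ⁅a,b⁆ for all a,b ∈ V₊, and ⁅a,b⁆′ = −⁅a,b⁆ for all a,b ∈ V₋. -/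
/-!
Theorem 8.1 of the paper: two triple-compatible Lie brackets on a
finite-dimensional vector space over a field of characteristic 0, the
first of which is semisimple (equivalently, over a characteristic-0
field: has nondegenerate Killing form), split the space into a direct
sum of two common ideals on which the brackets agree resp. are
negatives of each other.
-/

variable {k V : Type*} [Field k] [CharZero k] [AddCommGroup V] [Module k V]
  [FiniteDimensional k V]

/-- `B` is a Lie bracket: alternating bilinear and satisfying the Jacobi identity. -/
def IsLieBracket (B : V →ₗ[k] V →ₗ[k] V) : Prop :=
  (∀ a, B a a = 0) ∧ ∀ a b c, B (B a b) c + B (B b c) a + B (B c a) b = 0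

/-- Triple-compatibility of two brackets: `⁅⁅a,b⁆,c⁆ = ⁅⁅a,b⁆′,c⁆′`. -/
def TripleCompat (B B' : V →ₗ[k] V →ₗ[k] V) : Prop :=
  ∀ a b c, B (B a b) c = B' (B' a b) c

/-- `ad_a x = ⁅x, a⁆`. -/
def lieAd (B : V →ₗ[k] V →ₗ[k] V) (a : V) : V →ₗ[k] V := B.flip a

/-- The Killing form `B(a,b) = tr (ad_a ∘ ad_b)`. -/
noncomputable def killingF (B : V →ₗ[k] V →ₗ[k] V) (a b : V) : k :=
  LinearMap.trace k V (lieAd B a ∘ₗ lieAd B b)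

section

variable {K W : Type*} [Field K] [AddCommGroup W] [Module K W] {B B' : W →ₗ[K] W →ₗ[K] W}

namespace IsLieBracket

theorem skew (hB : IsLieBracket B) (a b : W) : B a b = -B b a := by
  have h := hB.1 (a + b)
  simp only [map_add, LinearMap.add_apply, hB.1, zero_add, add_zero] at h
  exact eq_neg_of_add_eq_zero_right h

theorem leibniz (hB : IsLieBracket B) (a b c : W) :
    B (B a b) c = B a (B b c) - B b (B a c) := by
  have h := hB.2 a b c
  rw [hB.skew (B b c) a, hB.skew (B c a) b, hB.skew c a, map_neg, neg_neg] at h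
  rw [← sub_eq_zero, ← h]
  abel

theorem lieAd_bracket (hB : IsLieBracket B) (a b : W) :
    lieAd B (B a b) = lieAd B b * lieAd B a - lieAd B a * lieAd B b := by
  ext x
  simp only [lieAd, LinearMap.flip_apply, LinearMap.sub_apply, Module.End.mul_apply]
  rw [hB.skew x, hB.leibniz, hB.skew (B x a) b, hB.skew (B x b) a, hB.skew x a, hB.skew x b,
    map_neg, map_neg]
  abel

theorem killingF_bracket (hB : IsLieBracket B) (a b c : W) :
    killingF B (B a b) c = killingF B a (B b c) := by
  simp only [killingF, ← Module.End.mul_eq_comp, hB.lieAd_bracket, sub_mul, mul_sub, map_sub]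
  rw [mul_assoc, LinearMap.trace_mul_comm K (lieAd B b), mul_assoc, mul_assoc]

theorem eq_zero_of_bracket_eq_zero (hB : IsLieBracket B)
    (hss : ∀ a : W, (∀ b : W, killingF B a b = 0) → a = 0) {a : W} (ha : ∀ b, B a b = 0) :
    a = 0 := by
  have h : lieAd B a = 0 := by
    ext x
    simp [lieAd, hB.skew x a, ha]
  exact hss a fun b => by simp [killingF, h]

theorem span_bracket_eq_top [FiniteDimensional K W] (hB : IsLieBracket B)
    (hss : ∀ a : W, (∀ b : W, killingF B a b = 0) → a = 0) :
    Submodule.span K {x | ∃ a b, B a b = x} = ⊤ := by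
  by_contra hne
  obtain ⟨f, hf, hle⟩ := Submodule.exists_le_ker_of_lt_top _ (lt_top_iff_ne_top.2 hne)
  let φ : W →ₗ[K] Module.Dual K W :=
    ((LinearMap.mul K (Module.End K W)).compl₁₂ B.flip B.flip).compr₂ (LinearMap.trace K W)
  have hφ : ∀ a b, φ a b = killingF B a b := fun _ _ => rfl
  have hinj : Function.Injective φ := by
    refine (injective_iff_map_eq_zero φ).2 fun a ha => hss a fun b => ?_
    rw [← hφ, ha, LinearMap.zero_apply]
  obtain ⟨a, rfl⟩ := (LinearMap.injective_iff_surjective_of_finrank_eq_finrank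
    Subspace.dual_finrank_eq.symm).1 hinj f
  refine hf ?_
  rw [hB.eq_zero_of_bracket_eq_zero hss (a := a), map_zero]
  refine fun b => hss _ fun c => ?_
  rw [hB.killingF_bracket, ← hφ]
  exact hle (Submodule.subset_span ⟨b, c, rfl⟩)

end IsLieBracket

theorem TripleCompat.killingF_eq (h : TripleCompat B B') (a b : W) :
    killingF B' a b = killingF B a b := by
  unfold killingF
  congr 1
  ext x
  exact (h x b a).symm

/-- Triple-compatible brackets, the first of them semisimple, differ by an involution in the
centroid of the first. -/
theorem TripleCompat.exists_involution [FiniteDimensional K W]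
    (hcompat : TripleCompat B B') (hB : IsLieBracket B) (hB' : IsLieBracket B')
    (hss : ∀ a : W, (∀ b : W, killingF B a b = 0) → a = 0) :
    ∃ T : W →ₗ[K] W, (∀ x, T (T x) = x) ∧ (∀ a b, B' a b = T (B a b)) ∧
      ∀ a b, B (T a) b = T (B a b) := by
  have hss' : ∀ a : W, (∀ b : W, killingF B' a b = 0) → a = 0 := by
    simpa only [hcompat.killingF_eq] using hss
  have hspan := hB.span_bracket_eq_top hss
  have huniq : ∀ {x y : W}, (∀ c, B' x c = B' y c) → x = y := fun {x y} h =>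
    sub_eq_zero.1 <| hB'.eq_zero_of_bracket_eq_zero hss' fun c => by
      rw [map_sub, LinearMap.sub_apply, h, sub_self]
  have hex : ∀ x : W, ∃ y, ∀ c, B' y c = B x c := by
    intro x
    have hx : x ∈ Submodule.span K {x | ∃ a b, B a b = x} := hspan ▸ Submodule.mem_top
    induction hx using Submodule.span_induction with
    | mem x h =>
      obtain ⟨a, b, rfl⟩ := h
      exact ⟨B' a b, fun c => (hcompat a b c).symm⟩
    | zero => exact ⟨0, fun c => by simp⟩
    | add x y _ _ hx hy =>
      obtain ⟨u, hu⟩ := hx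
      obtain ⟨v, hv⟩ := hy
      exact ⟨u + v, fun c => by simp [hu, hv]⟩
    | smul r x _ hx =>
      obtain ⟨u, hu⟩ := hx
      exact ⟨r • u, fun c => by simp [hu]⟩
  choose t ht using hex
  let T : W →ₗ[K] W :=
    { toFun := t
      map_add' := fun x y => huniq fun c => by simp [ht]
      map_smul' := fun r x => huniq fun c => by simp [ht] }
  have hT : ∀ x c, B' (T x) c = B x c := ht
  have hTB : ∀ a b, T (B a b) = B' a b := fun a b => huniq fun c => by rw [hT, hcompat]
  have hTT : ∀ a b, T (T (B a b)) = B a b := by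
    intro a b
    have h : T (B a b) = B a (T b) := by
      rw [← hT a (T b)]
      refine huniq fun c => ?_
      rw [hT, hB'.leibniz, hT, hT, hT, hT, hB.leibniz]
    rw [h, hB.skew, map_neg, hTB, hT, ← hB.skew]
  have hinv : ∀ x, T (T x) = x := by
    intro x
    have hx : x ∈ Submodule.span K {x | ∃ a b, B a b = x} := hspan ▸ Submodule.mem_top
    induction hx using Submodule.span_induction with
    | mem x h =>
      obtain ⟨a, b, rfl⟩ := h
      exact hTT a b
    | zero => simp
    | add x y _ _ hx hy => simp [hx, hy]
    | smul r x _ hx => simp [hx]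
  exact ⟨T, hinv, fun a b => (hTB a b).symm, fun a b => by rw [← hT a b, ← hTB, hinv]⟩

end

theorem cartan_triple_system_decomposition
    (B B' : V →ₗ[k] V →ₗ[k] V)
    (hB : IsLieBracket B) (hB' : IsLieBracket B')
    (hcompat : TripleCompat B B')
    -- `(V, B)` is semisimple: its Killing form is nondegenerate
    (hss : ∀ a : V, (∀ b : V, killingF B a b = 0) → a = 0) :
    -- `(V, B')` is semisimple,
    (∀ a : V, (∀ b : V, killingF B' a b = 0) → a = 0) ∧
    -- and `V` splits as a direct sum `V₊ ⊕ V₋` of ideals for both brackets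
    ∃ Vp Vm : Submodule k V,
      Vp ⊓ Vm = ⊥ ∧ Vp ⊔ Vm = ⊤ ∧
      (∀ x ∈ Vp, ∀ v : V, B x v ∈ Vp) ∧
      (∀ x ∈ Vp, ∀ v : V, B' x v ∈ Vp) ∧
      (∀ x ∈ Vm, ∀ v : V, B x v ∈ Vm) ∧
      (∀ x ∈ Vm, ∀ v : V, B' x v ∈ Vm) ∧
      (∀ a ∈ Vp, ∀ b ∈ Vp, B' a b = B a b) ∧
      (∀ a ∈ Vm, ∀ b ∈ Vm, B' a b = -B a b) := by
  refine ⟨by simpa only [hcompat.killingF_eq] using hss, ?_⟩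
  obtain ⟨T, hinv, hT, hcent⟩ := hcompat.exists_involution hB hB' hss
  refine ⟨LinearMap.ker (T - 1), LinearMap.ker (T + 1), ?_⟩
  have hp : ∀ x, x ∈ LinearMap.ker (T - 1) ↔ T x = x := fun x => by simp [sub_eq_zero]
  have hm : ∀ x, x ∈ LinearMap.ker (T + 1) ↔ T x = -x := fun x => by
    simp [add_eq_zero_iff_eq_neg]
  refine ⟨?_, ?_, ?_, ?_, ?_, ?_, ?_, ?_⟩
  · refine (Submodule.eq_bot_iff _).2 fun x hx => ?_
    have h : x = -x := ((hp x).1 hx.1).symm.trans ((hm x).1 hx.2)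
    have h2 : (2 : k) • x = 0 := by rw [two_smul]; nth_rewrite 1 [h]; exact neg_add_cancel x
    exact (smul_eq_zero.1 h2).resolve_left two_ne_zero
  · refine Submodule.eq_top_iff'.2 fun x => Submodule.mem_sup.2
      ⟨(2⁻¹ : k) • (x + T x), (hp _).2 ?_, (2⁻¹ : k) • (x - T x), (hm _).2 ?_, ?_⟩
    · rw [map_smul, map_add, hinv, add_comm]
    · rw [map_smul, map_sub, hinv, ← smul_neg, neg_sub]
    · rw [← smul_add, add_add_sub_cancel, ← two_smul k x, inv_smul_smul₀ two_ne_zero]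
  · intro x hx v
    rw [hp] at hx ⊢
    rw [← hcent, hx]
  · intro x hx v
    rw [hp] at hx ⊢
    rw [hT, ← hcent, hx, ← hcent, hx]
  · intro x hx v
    rw [hm] at hx ⊢
    rw [← hcent, hx, map_neg, LinearMap.neg_apply]
  · intro x hx v
    rw [hm] at hx ⊢
    rw [hT, hinv, ← hcent, hx, map_neg, LinearMap.neg_apply, neg_neg]
  · intro a ha b _
    rw [hT, ← hcent, (hp a).1 ha]
  · intro a ha b _
    rw [hT, ← hcent, (hm a).1 ha, map_neg, LinearMap.neg_apply]
end

section
/- Let g and g′ be finite-dimensional real Lie algebras with brackets ⁅·,·⁆ and ⁅·,·⁆′ respectively, and let f : g → g′ be a linear isomorphism satisfying ⁅⁅f(a),f(b)⁆′,f(c)⁆′ = f(⁅⁅a,b⁆,c⁆) for all a,b,c ∈ g. If g is simple, then either ⁅f(a),f(b)⁆′ = f(⁅a,b⁆) for all a,b ∈ g, or ⁅f(a),f(b)⁆′ = −f(⁅a,b⁆) for all a,b ∈ g. -/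
/-!
E. Cartan's theorem (Theorem 4.5 of the paper): a linear isomorphism of
finite-dimensional real Lie algebras intertwining the triple brackets
`⁅⁅·,·⁆,·⁆` is, when the source is simple, either an isomorphism or an
anti-isomorphism of Lie algebras.
-/

namespace LieAlgebra

theorem IsSimple.lie_top_top {R L : Type*} [CommRing R] [LieRing L] [LieAlgebra R L]
    [IsSimple R L] : ⁅(⊤ : LieIdeal R L), (⊤ : LieIdeal R L)⁆ = ⊤ := by
  refine (IsSimple.eq_bot_or_eq_top (R := R) _).resolve_left fun h ↦ ?_
  refine IsSimple.non_abelian R (L := L) ⟨fun x y ↦ ?_⟩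
  rw [← LieSubmodule.mem_bot (R := R) (L := L), ← h]
  exact LieSubmodule.lie_mem_lie (LieSubmodule.mem_top x) (LieSubmodule.mem_top y)

theorem IsSimple.eq_zero_of_forall_lie_eq_zero (R : Type*) {L : Type*} [CommRing R] [LieRing L]
    [LieAlgebra R L] [IsSimple R L] {x : L} (hx : ∀ y : L, ⁅x, y⁆ = 0) : x = 0 := by
  have hmem : x ∈ center R L := (LieModule.mem_maxTrivSubmodule R L L x).mpr fun y ↦ by
    rw [← lie_skew, hx, neg_zero]
  rwa [center_eq_bot, LieSubmodule.mem_bot] at hmem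

theorem IsSimple.eq_of_forall_lie_eq (R : Type*) {L : Type*} [CommRing R] [LieRing L]
    [LieAlgebra R L] [IsSimple R L] {x y : L} (h : ∀ z : L, ⁅x, z⁆ = ⁅y, z⁆) : x = y :=
  sub_eq_zero.mp <| eq_zero_of_forall_lie_eq_zero R fun z ↦ by rw [sub_lie, h, sub_self]

/-- If `f` intertwines the triple brackets and the source is simple, then the pullback along `f` of
every adjoint endomorphism of the target is an adjoint endomorphism of the source. -/
theorem exists_forall_lie_map_eq_map_lie
    {R L L' : Type*} [CommRing R] [LieRing L] [LieAlgebra R L] [LieRing L'] [LieAlgebra R L']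
    [IsSimple R L] (f : L ≃ₗ[R] L') (hf : ∀ a b c : L, ⁅⁅f a, f b⁆, f c⁆ = f ⁅⁅a, b⁆, c⁆) (a : L) :
    ∃ a' : L, ∀ b, ⁅f a, f b⁆ = f ⁅a', b⁆ := by
  let S : Submodule R L :=
    { carrier := {a | ∃ a' : L, ∀ b, ⁅f a, f b⁆ = f ⁅a', b⁆}
      zero_mem' := ⟨0, by simp⟩
      add_mem' := by
        rintro x y ⟨x', hx⟩ ⟨y', hy⟩
        exact ⟨x' + y', fun b ↦ by simp [hx, hy]⟩
      smul_mem' := by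
        rintro r x ⟨x', hx⟩
        exact ⟨r • x', fun b ↦ by simp [hx]⟩ }
  have htriple (x y z : L) : ⁅⁅x, y⁆, z⁆ ∈ S := by
    refine ⟨⁅f.symm ⁅f x, f y⁆, z⁆, fun b ↦ ?_⟩
    rw [← hf, ← hf, f.apply_symm_apply]
  have hlie (u z : L) : ⁅u, z⁆ ∈ S := by
    have hu : u ∈ (⁅(⊤ : LieIdeal R L), (⊤ : LieIdeal R L)⁆ : LieIdeal R L).toSubmodule := by
      simp [IsSimple.lie_top_top]
    rw [LieSubmodule.lieIdeal_oper_eq_linear_span'] at hu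
    induction hu using Submodule.span_induction with
    | mem u hu =>
      obtain ⟨x, -, y, -, rfl⟩ := hu
      exact htriple x y z
    | zero => simp
    | add u v _ _ hu hv => simpa using S.add_mem hu hv
    | smul r u _ hu => simpa using S.smul_mem r hu
  have ha : a ∈ (⁅(⊤ : LieIdeal R L), (⊤ : LieIdeal R L)⁆ : LieIdeal R L).toSubmodule := by
    simp [IsSimple.lie_top_top]
  rw [LieSubmodule.lieIdeal_oper_eq_linear_span'] at ha
  refine (Submodule.span_le (p := S)).mpr ?_ ha
  rintro _ ⟨x, -, y, -, rfl⟩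
  exact hlie x y

/-- A linear isomorphism intertwining the triple brackets, with simple source, is either an
isomorphism or an anti-isomorphism of Lie algebras. -/
theorem lie_map_eq_map_lie_or_eq_neg_map_lie
    {R L L' : Type*} [CommRing R] [LieRing L] [LieAlgebra R L] [LieRing L'] [LieAlgebra R L']
    [IsSimple R L] (f : L ≃ₗ[R] L') (hf : ∀ a b c : L, ⁅⁅f a, f b⁆, f c⁆ = f ⁅⁅a, b⁆, c⁆) :
    (∀ a b : L, ⁅f a, f b⁆ = f ⁅a, b⁆) ∨ (∀ a b : L, ⁅f a, f b⁆ = -f ⁅a, b⁆) := by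
  choose φ hφ using exists_forall_lie_map_eq_map_lie f hf
  have hskew (a b : L) : ⁅φ a, b⁆ = ⁅a, φ b⁆ := by
    apply f.injective
    rw [← hφ, ← lie_skew, hφ, ← lie_skew a, map_neg]
  have hφlie (a b : L) : φ ⁅φ a, b⁆ = ⁅a, b⁆ := by
    refine IsSimple.eq_of_forall_lie_eq R fun c ↦ f.injective ?_
    rw [← hφ, ← hφ, hf]
  have hmul (a b : L) : ⁅φ a, φ b⁆ = ⁅a, b⁆ := by
    refine IsSimple.eq_of_forall_lie_eq R fun c ↦ f.injective ?_
    rw [← hf a b c, lie_lie, lie_lie, hφ b c, hφ a c, hφ, hφ, map_sub]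
  have hinv (a : L) : φ (φ a) = a :=
    IsSimple.eq_of_forall_lie_eq R fun b ↦ by rw [hskew, hmul]
  have hcent (a b : L) : φ ⁅a, b⁆ = ⁅a, φ b⁆ := by
    rw [← hskew, ← hφlie (φ a) b, hinv]
  let I : LieIdeal R L :=
    { carrier := {a | ∀ b, ⁅f a, f b⁆ = f ⁅a, b⁆}
      zero_mem' := by simp
      add_mem' := fun {x y} hx hy b ↦ by simp [hx b, hy b]
      smul_mem' := fun r x hx b ↦ by simp [hx b]
      lie_mem := fun {x a} ha b ↦ by
        have hfix : φ a = a := IsSimple.eq_of_forall_lie_eq R fun c ↦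
          f.injective <| by rw [← hφ, ha]
        rw [hφ, hcent, hfix] }
  rcases IsSimple.eq_bot_or_eq_top (R := R) I with hI | hI
  · right
    intro a b
    have hmem : φ a + a ∈ I := fun c ↦ by
      rw [map_add, add_lie, hφ, hφ, hinv, ← map_add, ← add_lie, add_comm]
    rw [hI, LieSubmodule.mem_bot] at hmem
    rw [hφ, eq_neg_of_add_eq_zero_left hmem, neg_lie, map_neg]
  · left
    intro a
    have hmem : a ∈ I := hI ▸ LieSubmodule.mem_top a
    exact hmem

end LieAlgebra

theorem cartan_simple_iso_or_anti_iso
    {L L' : Type*} [LieRing L] [LieAlgebra ℝ L] [LieRing L'] [LieAlgebra ℝ L']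
    [FiniteDimensional ℝ L] [FiniteDimensional ℝ L']
    (hsimple : LieAlgebra.IsSimple ℝ L)
    (f : L ≃ₗ[ℝ] L')
    (hf : ∀ a b c : L, ⁅⁅f a, f b⁆, f c⁆ = f ⁅⁅a, b⁆, c⁆) :
    (∀ a b : L, ⁅f a, f b⁆ = f ⁅a, b⁆) ∨ (∀ a b : L, ⁅f a, f b⁆ = -f ⁅a, b⁆) :=
  LieAlgebra.lie_map_eq_map_lie_or_eq_neg_map_lie f hf
end

section
/- Let V be a finite-dimensional vector space over a field k of characteristic 0 and let ⁅·,·⁆, ⁅·,·⁆′ be triple-compatible Lie brackets on V. Then for every a ∈ V the Fitting null components of ad_a and ad′_a coincide: {x ∈ V : ad_aᵛ(x) = 0 for some ν ∈ ℕ} = {x ∈ V : (ad′_a)ᵛ(x) = 0 for some ν ∈ ℕ}. -/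
/-!
For triple-compatible Lie brackets on a finite-dimensional vector space
over a field of characteristic 0, the Fitting null components of `ad_a`
and `ad′_a` coincide for every `a`.
-/

variable {k V : Type*} [Field k] [CharZero k] [AddCommGroup V] [Module k V]
  [FiniteDimensional k V]

/-- Triple-compatible brackets have the same squared adjoint maps. -/
theorem TripleCompat.lieAd_sq_eq {k V : Type*} [Field k] [AddCommGroup V] [Module k V]
    {B B' : V →ₗ[k] V →ₗ[k] V} (h : TripleCompat B B') (a : V) :
    lieAd B a ^ 2 = lieAd B' a ^ 2 := by
  ext x
  simpa [pow_two, lieAd] using h x a a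

/-- Endomorphisms with equal squares have the same Fitting null component. -/
theorem exists_pow_apply_eq_zero_of_sq_eq {k V : Type*} [Field k] [AddCommGroup V] [Module k V]
    {S T : V →ₗ[k] V} (h : S ^ 2 = T ^ 2) {x : V} (hx : ∃ ν : ℕ, (S ^ ν) x = 0) :
    ∃ ν : ℕ, (T ^ ν) x = 0 := by
  obtain ⟨ν, hν⟩ := hx
  refine ⟨2 * ν, ?_⟩
  rw [pow_mul, ← h, ← pow_mul, two_mul, pow_add, Module.End.mul_apply, hν, map_zero]

theorem fitting_null_components_eq
    (B B' : V →ₗ[k] V →ₗ[k] V)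
    (hB : IsLieBracket B) (hB' : IsLieBracket B')
    (hcompat : TripleCompat B B') :
    ∀ a : V,
      {x : V | ∃ ν : ℕ, ((lieAd B a) ^ ν) x = 0} =
        {x : V | ∃ ν : ℕ, ((lieAd B' a) ^ ν) x = 0} := by
  intro a
  ext x
  exact ⟨exists_pow_apply_eq_zero_of_sq_eq (hcompat.lieAd_sq_eq a),
    exists_pow_apply_eq_zero_of_sq_eq (hcompat.lieAd_sq_eq a).symm⟩
end

section
/- Let W be a complex vector space, Ω : W × W → ℂ an alternating ℂ-bilinear form, and V ⊆ W an ℝ-linear subspace. Suppose there exists an alternating ℝ-bilinear form ω : V × V → ℝ that is nondegenerate (i.e. if v ∈ V and ω(v,w) = 0 for all w ∈ V then v = 0) and satisfies Ω(v,w) = −i·ω(v,w) for all v,w ∈ V. Then V is totally real in W, that is, V ∩ iV = {0}. -/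
/-!
Linear-algebra content of Lemma 6.5 of the paper: if a complex alternating
bilinear form `Ω` on a complex vector space `W` restricts on a real subspace
`V` to `-i·ω` with `ω` a nondegenerate real alternating bilinear form, then
`V` is totally real: `V ∩ iV = {0}`.
-/

theorem totally_real_of_nondegenerate
    {W : Type*} [AddCommGroup W] [Module ℂ W]
    (Ω : W →ₗ[ℂ] W →ₗ[ℂ] ℂ) (hΩalt : ∀ w : W, Ω w w = 0)
    (V : Submodule ℝ W)
    (ω : V →ₗ[ℝ] V →ₗ[ℝ] ℝ)
    (hωalt : ∀ v : V, ω v v = 0)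
    (hωnd : ∀ v : V, (∀ w : V, ω v w = 0) → v = 0)
    (hrel : ∀ v w : V, Ω (v : W) (w : W) = -Complex.I * (ω v w : ℂ)) :
    (V : Set W) ∩ ((fun v : W => (Complex.I : ℂ) • v) '' (V : Set W)) = {0} := by
  refine Set.Subset.antisymm ?_ (Set.singleton_subset_iff.mpr
    ⟨V.zero_mem, 0, V.zero_mem, smul_zero _⟩)
  rintro _ ⟨hIu, u, hu, rfl⟩
  have hu0 : (⟨u, hu⟩ : V) = 0 := hωnd _ fun w => by
    have hIuw := hrel ⟨Complex.I • u, hIu⟩ w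
    have huw := hrel ⟨u, hu⟩ w
    simp only [map_smul, LinearMap.smul_apply, smul_eq_mul] at hIuw huw
    rw [huw] at hIuw
    simpa using congrArg Complex.re hIuw
  have : u = 0 := congrArg Subtype.val hu0
  simp [this]
end
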